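/- Fix an integer n ≥ 0, a real R ∈ (0,1) and a real p ≥ 1 with p ≠ 3. For k = 1,2,… let α_k = γ_{n,k} be the k-th positive zero of the spherical Bessel function j_n and set G_k(p) = ( ∫_{α_k R}^{α_k} z² |j_n(z)|^p dz / ∫_0^{α_k} z² |j_n(z)|^p dz )^{1/p}. Then lim_{k→∞} G_k(p) = (1 − R^{3 − p})^{1/p} if 1 ≤ p < 3, and lim_{k→∞} G_k(p) = 0 if p > 3. (G_k(p) equals the ratio ‖u_{n,k}‖_{L_p(B(R))}/‖u_{n,k}‖_{L_p(B)} for the Dirichlet eigenfunctions of the unit ball B, where B(R) = {x ∈ ℝ³ : R < |x| < 1}; thus focusing modes in the ball are L_p-localized at the origin precisely when p > 3.) -/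

import Mathlib

open Real MeasureTheory Filter Topology

/-- The Bessel function of the first kind of order `ν`. -/
noncomputable def besselJ (ν : ℝ) (x : ℝ) : ℝ :=
  ∑' k : ℕ, ((-1 : ℝ) ^ k / ((k.factorial : ℝ) * Real.Gamma ((k : ℝ) + ν + 1))) *
    (x / 2) ^ (2 * (k : ℝ) + ν)

/-- The spherical Bessel function `j_n(x) = √(π/(2x)) J_{n+1/2}(x)`. -/
noncomputable def sbesselJ (n : ℕ) (x : ℝ) : ℝ :=
  Real.sqrt (π / (2 * x)) * besselJ ((n : ℝ) + 1 / 2) x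

/-- `G_k(p) = ( ∫_{α_k R}^{α_k} z² |j_n(z)|^p dz / ∫_0^{α_k} z² |j_n(z)|^p dz )^{1/p}`, equal to
`‖u_{n,k}‖_{L_p(B(R))}/‖u_{n,k}‖_{L_p(B)}` for the Dirichlet eigenfunctions of the unit ball. -/
noncomputable def focusRatioBall (n : ℕ) (R p : ℝ) (αk : ℝ) : ℝ :=
  ((∫ z in (αk * R)..αk, z ^ 2 * |sbesselJ n z| ^ p) /
    (∫ z in (0 : ℝ)..αk, z ^ 2 * |sbesselJ n z| ^ p)) ^ (1 / p)


/-- Elementary form of the Riccati-Bessel functions. -/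
noncomputable def ricU : ℕ → ℝ → ℝ
  | 0, x => cos x
  | 1, x => sin x
  | (m + 2), x => ((2 * (m : ℝ) + 1) / x) * ricU (m + 1) x - ricU m x

lemma ric_half_pow (x : ℝ) (hx : 0 < x) : (x / 2) ^ (-(1/2) : ℝ) = √π * √(2 / (π * x)) := by
  rw [Real.rpow_neg (by positivity), ← Real.sqrt_eq_rpow, ← Real.sqrt_mul (by positivity),
    ← Real.sqrt_inv]
  congr 1
  field_simp

lemma ric_term_zero (x : ℝ) (hx : 0 < x) (k : ℕ) :
    ((-1 : ℝ) ^ k / ((k.factorial : ℝ) * Real.Gamma ((k : ℝ) + (-(1/2)) + 1))) *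
      (x / 2) ^ (2 * (k : ℝ) + (-(1/2))) =
    √(2 / (π * x)) * ((-1) ^ k * x ^ (2 * k) / (2 * k).factorial) := by
  have hx2 : 0 < x / 2 := by positivity
  have h1 := Real.Gamma_mul_Gamma_add_half ((k : ℝ) + 1/2)
  have e1 : (k : ℝ) + 1/2 + 1/2 = k + 1 := by ring
  have e2 : 2 * ((k : ℝ) + 1/2) = ((2 * k : ℕ) : ℝ) + 1 := by push_cast; ring
  have e3 : 1 - (((2 * k : ℕ) : ℝ) + 1) = -((2 * k : ℕ) : ℝ) := by ring
  rw [e1, e2, Real.Gamma_nat_eq_factorial, Real.Gamma_nat_eq_factorial, e3,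
    Real.rpow_neg (by norm_num), Real.rpow_natCast] at h1
  have e4 : (k : ℝ) + (-(1/2)) + 1 = k + 1/2 := by ring
  rw [e4, mul_comm (k.factorial : ℝ), h1, Real.rpow_add hx2, ric_half_pow x hx]
  have e5 : (x / 2) ^ (2 * (k : ℝ)) = (x / 2) ^ (2 * k) := by
    rw [← Real.rpow_natCast]; push_cast; rfl
  rw [e5, div_pow]
  have : (0:ℝ) < √π := by positivity
  have : (0:ℝ) < (2 * k).factorial := by positivity
  field_simp

lemma ric_term_one (x : ℝ) (hx : 0 < x) (k : ℕ) :
    ((-1 : ℝ) ^ k / ((k.factorial : ℝ) * Real.Gamma ((k : ℝ) + (1/2) + 1))) *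
      (x / 2) ^ (2 * (k : ℝ) + (1/2)) =
    √(2 / (π * x)) * ((-1) ^ k * x ^ (2 * k + 1) / (2 * k + 1).factorial) := by
  have hx2 : 0 < x / 2 := by positivity
  have h1 := Real.Gamma_mul_Gamma_add_half ((k : ℝ) + 1)
  have e2 : 2 * ((k : ℝ) + 1) = ((2 * k + 1 : ℕ) : ℝ) + 1 := by push_cast; ring
  have e3 : 1 - (((2 * k + 1 : ℕ) : ℝ) + 1) = -((2 * k + 1 : ℕ) : ℝ) := by ring
  rw [e2, Real.Gamma_nat_eq_factorial, Real.Gamma_nat_eq_factorial, e3,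
    Real.rpow_neg (by norm_num), Real.rpow_natCast] at h1
  have e4 : (k : ℝ) + (1/2) + 1 = k + 1 + 1/2 := by ring
  have e6 : 2 * (k : ℝ) + 1/2 = ((2 * k + 1 : ℕ) : ℝ) + (-(1/2)) := by push_cast; ring
  rw [e4, h1, e6, Real.rpow_add hx2, ric_half_pow x hx, Real.rpow_natCast, div_pow]
  have : (0:ℝ) < √π := by positivity
  have : (0:ℝ) < (2 * k + 1).factorial := by positivity
  field_simp

/-- The terms of the Bessel series. -/
noncomputable def besT (ν x : ℝ) (k : ℕ) : ℝ :=
  ((-1 : ℝ) ^ k / ((k.factorial : ℝ) * Real.Gamma ((k : ℝ) + ν + 1))) *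
    (x / 2) ^ (2 * (k : ℝ) + ν)

lemma besT_rec (ν x : ℝ) (hν : 0 < ν) (hx : 0 < x) (k : ℕ) :
    besT (ν + 1) x k = (2 * ν / x) * besT ν x (k + 1) - besT (ν - 1) x (k + 1) := by
  unfold besT
  have hx2 : 0 < x / 2 := by positivity
  have a1 : (k : ℝ) + (ν + 1) + 1 = (k + ν + 1) + 1 := by ring
  have a2 : ((k + 1 : ℕ) : ℝ) + ν + 1 = (k + ν + 1) + 1 := by push_cast; ring
  have a3 : ((k + 1 : ℕ) : ℝ) + (ν - 1) + 1 = k + ν + 1 := by push_cast; ring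
  have b1 : 2 * (k : ℝ) + (ν + 1) = (2 * k + ν) + 1 := by ring
  have b2 : 2 * ((k + 1 : ℕ) : ℝ) + ν = (2 * k + ν) + 1 + 1 := by push_cast; ring
  have b3 : 2 * ((k + 1 : ℕ) : ℝ) + (ν - 1) = (2 * k + ν) + 1 := by push_cast; ring
  have hk : (0:ℝ) < k + ν + 1 := by positivity
  have hG := Real.Gamma_pos_of_pos hk
  rw [a1, a2, a3, b1, b2, b3, Real.Gamma_add_one hk.ne', Real.rpow_add hx2 (2 * k + ν + 1) 1,
    Real.rpow_add hx2 (2 * k + ν) 1, Real.rpow_one, Nat.factorial_succ, pow_succ]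
  push_cast
  have : (0:ℝ) < k.factorial := by positivity
  field_simp
  ring

lemma besT_rec_zero (ν x : ℝ) (hν : 0 < ν) (hx : 0 < x) :
    (2 * ν / x) * besT ν x 0 - besT (ν - 1) x 0 = 0 := by
  unfold besT
  have hx2 : 0 < x / 2 := by positivity
  have hG := Real.Gamma_pos_of_pos hν
  have e : 2 * ((0 : ℕ) : ℝ) + ν = (2 * ((0 : ℕ) : ℝ) + (ν - 1)) + 1 := by ring
  have a : ((0 : ℕ) : ℝ) + (ν - 1) + 1 = ν := by push_cast; ring
  have a' : ((0 : ℕ) : ℝ) + ν + 1 = ν + 1 := by push_cast; ring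
  rw [e, a, a', Real.Gamma_add_one hν.ne', Real.rpow_add hx2 _ 1, Real.rpow_one]
  simp
  field_simp
  ring

lemma ric_hasSum (x : ℝ) (hx : 0 < x) (m : ℕ) :
    HasSum (besT ((m : ℝ) - 1/2) x) (√(2 / (π * x)) * ricU m x) ∧
    HasSum (besT (((m + 1 : ℕ) : ℝ) - 1/2) x) (√(2 / (π * x)) * ricU (m + 1) x) := by
  induction m with
  | zero =>
    constructor
    · have h := (Real.hasSum_cos x).mul_left (√(2 / (π * x)))
      have e : ((0 : ℕ) : ℝ) - 1/2 = -(1/2) := by norm_num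
      have e2 : besT (((0 : ℕ) : ℝ) - 1/2) x = fun k : ℕ =>
          √(2 / (π * x)) * ((-1) ^ k * x ^ (2 * k) / (2 * k).factorial) := by
        rw [e]; exact funext fun k => ric_term_zero x hx k
      rw [e2, ricU]; exact h
    · have h := (Real.hasSum_sin x).mul_left (√(2 / (π * x)))
      have e : ((0 + 1 : ℕ) : ℝ) - 1/2 = 1/2 := by norm_num
      have e2 : besT (((0 + 1 : ℕ) : ℝ) - 1/2) x = fun k : ℕ =>
          √(2 / (π * x)) * ((-1) ^ k * x ^ (2 * k + 1) / (2 * k + 1).factorial) := by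
        rw [e]; exact funext fun k => ric_term_one x hx k
      rw [e2, ricU]; exact h
  | succ m ih =>
    refine ⟨ih.2, ?_⟩
    have hν : (0:ℝ) < ((m + 1 : ℕ) : ℝ) - 1/2 := by push_cast; linarith [Nat.cast_nonneg (α := ℝ) m]
    set ν : ℝ := ((m + 1 : ℕ) : ℝ) - 1/2 with hνd
    have e1 : ((m + 1 + 1 : ℕ) : ℝ) - 1/2 = ν + 1 := by rw [hνd]; push_cast; ring
    have e2 : (m : ℝ) - 1/2 = ν - 1 := by rw [hνd]; push_cast; ring
    rw [e1]
    rw [e2] at ih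
    have h := (ih.2.mul_left (2 * ν / x)).sub ih.1
    rw [← hasSum_nat_add_iff' 1] at h
    simp only [Finset.sum_range_one, besT_rec_zero ν x hν hx, sub_zero] at h
    have e3 : besT (ν + 1) x = fun k => (2 * ν / x) * besT ν x (k + 1) - besT (ν - 1) x (k + 1) :=
      funext fun k => besT_rec ν x hν hx k
    rw [e3]
    convert! h using 1
    have : 2 * ν = 2 * (m : ℝ) + 1 := by rw [hνd]; push_cast; ring
    rw [this, ricU]
    ring

lemma sbesselJ_eq (n : ℕ) (x : ℝ) (hx : 0 < x) : sbesselJ n x = ricU (n + 1) x / x := by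
  have h := (ric_hasSum x hx n).2
  have e : ((n + 1 : ℕ) : ℝ) - 1/2 = (n : ℝ) + 1/2 := by push_cast; ring
  rw [e] at h
  have h2 : besselJ ((n : ℝ) + 1/2) x = √(2 / (π * x)) * ricU (n + 1) x := h.tsum_eq
  rw [sbesselJ, h2, ← mul_assoc, ← Real.sqrt_mul (by positivity)]
  have : π / (2 * x) * (2 / (π * x)) = (x⁻¹) ^ 2 := by
    field_simp
  rw [this, Real.sqrt_sq (by positivity)]
  ring

/-- Boundedness near the origin. -/
lemma sbesselJ_bound (n : ℕ) : ∃ C : ℝ, ∀ x ∈ Set.Ioc (0:ℝ) 1, |sbesselJ n x| ≤ C := by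
  set ν : ℝ := (n : ℝ) + 1/2 with hν
  have hνp : 0 < ν := by positivity
  have hGp : 0 < Real.Gamma (ν + 1) := Real.Gamma_pos_of_pos (by positivity)
  have hG : ∀ k : ℕ, Real.Gamma (ν + 1) ≤ Real.Gamma ((k : ℝ) + ν + 1) := by
    intro k
    induction k with
    | zero => simp
    | succ k ih =>
      have e : ((k + 1 : ℕ) : ℝ) + ν + 1 = ((k : ℝ) + ν + 1) + 1 := by push_cast; ring
      rw [e, Real.Gamma_add_one (s := (k : ℝ) + ν + 1) (by positivity)]
      have : (1:ℝ) ≤ (k : ℝ) + ν + 1 := by linarith [Nat.cast_nonneg (α := ℝ) k]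
      exact ih.trans (le_mul_of_one_le_left (hGp.le.trans ih) this)
  refine ⟨√π * ((Real.exp 1) / Real.Gamma (ν + 1)), fun x hx => ?_⟩
  obtain ⟨hx0, hx1⟩ := hx
  have hx2 : 0 < x / 2 := by positivity
  have hb : HasSum (fun k : ℕ => (x/2) ^ (1/2 : ℝ) * (1 / Real.Gamma (ν + 1)) * ((1:ℝ) ^ k / k.factorial))
      ((x/2) ^ (1/2 : ℝ) * (1 / Real.Gamma (ν + 1)) * Real.exp 1) := by
    refine HasSum.mul_left _ ?_
    rw [Real.exp_eq_exp_ℝ]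
    exact NormedSpace.expSeries_div_hasSum_exp (1:ℝ)
  have h := tsum_of_norm_bounded (f := besT ν x) hb (by
    intro k
    rw [besT, norm_mul, norm_div, norm_mul, norm_pow, norm_neg, norm_one, one_pow]
    rw [Real.norm_of_nonneg (by positivity : (0:ℝ) ≤ (k.factorial : ℝ)),
      Real.norm_of_nonneg (hGp.le.trans (hG k)), Real.norm_of_nonneg (by positivity)]
    have h1 : (x/2) ^ (2 * (k : ℝ) + ν) ≤ (x/2) ^ (1/2 : ℝ) := by
      apply Real.rpow_le_rpow_of_exponent_ge hx2 (by linarith)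
      rw [hν]; linarith [Nat.cast_nonneg (α := ℝ) k, Nat.cast_nonneg (α := ℝ) n]
    have h2 : 1 / ((k.factorial : ℝ) * Real.Gamma ((k : ℝ) + ν + 1)) ≤
        1 / ((k.factorial : ℝ) * Real.Gamma (ν + 1)) := by
      apply one_div_le_one_div_of_le (by positivity)
      exact mul_le_mul_of_nonneg_left (hG k) (by positivity)
    calc _ ≤ 1 / ((k.factorial : ℝ) * Real.Gamma (ν + 1)) * (x/2) ^ (1/2 : ℝ) :=
          mul_le_mul h2 h1 (by positivity) (by positivity)
      _ = _ := by field_simp)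
  have h3 : besselJ ν x = ∑' k, besT ν x k := rfl
  rw [sbesselJ, ← hν, h3, abs_mul, abs_of_nonneg (Real.sqrt_nonneg _)]
  rw [Real.norm_eq_abs] at h
  calc _ ≤ √(π / (2 * x)) * _ := mul_le_mul_of_nonneg_left h (Real.sqrt_nonneg _)
    _ = (√(π / (2 * x)) * √(x / 2)) * (Real.exp 1 / Real.Gamma (ν + 1)) := by
      rw [← Real.sqrt_eq_rpow]; ring
    _ ≤ √π * (Real.exp 1 / Real.Gamma (ν + 1)) := by
      refine mul_le_mul_of_nonneg_right ?_ (by positivity)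
      rw [← Real.sqrt_mul (by positivity)]
      apply Real.sqrt_le_sqrt
      have : π / (2 * x) * (x / 2) = π / 4 := by field_simp; norm_num
      rw [this]
      linarith [Real.pi_pos]

lemma ricU_cont (m : ℕ) : ContinuousOn (ricU m) (Set.Ioi 0) ∧
    ContinuousOn (ricU (m + 1)) (Set.Ioi 0) := by
  induction m with
  | zero =>
    constructor
    · have : ricU 0 = cos := by funext x; rw [ricU]
      rw [this]; exact Real.continuous_cos.continuousOn
    · have : ricU (0 + 1) = sin := by funext x; rw [ricU]
      rw [this]; exact Real.continuous_sin.continuousOn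
  | succ m ih =>
    refine ⟨ih.2, ?_⟩
    have : ricU (m + 1 + 1) = fun x => ((2 * (m : ℝ) + 1) / x) * ricU (m + 1) x - ricU m x := by
      funext x; rw [ricU]
    rw [this]
    refine ContinuousOn.sub (ContinuousOn.mul ?_ ih.2) ih.1
    exact continuousOn_const.div continuousOn_id fun x hx => (ne_of_gt hx)

lemma ricU_asymp (m : ℕ) :
    Tendsto (fun x => ricU m x - cos (x - m * (π / 2))) atTop (𝓝 0) ∧
    Tendsto (fun x => ricU (m + 1) x - cos (x - ((m + 1 : ℕ) : ℝ) * (π / 2))) atTop (𝓝 0) := by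
  induction m with
  | zero =>
    constructor
    · simp [ricU]
    · simp [ricU, Real.cos_sub_pi_div_two]
  | succ m ih =>
    refine ⟨ih.2, ?_⟩
    have h0 : Tendsto (fun x : ℝ => (2 * (m : ℝ) + 1) / x) atTop (𝓝 0) :=
      tendsto_const_nhds.div_atTop tendsto_id
    have h1 := h0.mul ih.2
    have h2 : Tendsto (fun x : ℝ => (2 * (m : ℝ) + 1) / x *
        cos (x - ((m + 1 : ℕ) : ℝ) * (π / 2))) atTop (𝓝 0) := by
      refine h0.zero_mul_isBoundedUnder_le ?_
      refine Filter.isBoundedUnder_of ⟨1, fun x => ?_⟩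
      exact Real.abs_cos_le_one _
    have h3 := (h1.add h2).sub ih.1
    simp only [mul_zero, add_zero, sub_zero] at h3
    refine h3.congr fun x => ?_
    have e : x - ((m + 1 + 1 : ℕ) : ℝ) * (π / 2) = (x - m * (π / 2)) - π := by push_cast; ring
    rw [e, Real.cos_sub_pi, ricU]
    ring

lemma ricU_ev_bound (m : ℕ) : ∀ᶠ x in atTop, |ricU m x| ≤ 2 := by
  have h := (ricU_asymp m).1
  rw [Metric.tendsto_nhds] at h
  filter_upwards [h 1 one_pos] with x hx
  rw [Real.dist_eq, sub_zero] at hx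
  have h1 := Real.abs_cos_le_one (x - m * (π / 2))
  calc |ricU m x| = |(ricU m x - cos (x - m * (π / 2))) + cos (x - m * (π / 2))| := by
        rw [sub_add_cancel]
    _ ≤ _ := abs_add_le _ _
    _ ≤ 2 := by linarith

lemma ricU_pow_asymp (m : ℕ) (p : ℝ) (hp : 0 ≤ p) :
    Tendsto (fun x => |ricU m x| ^ p - |cos (x - m * (π / 2))| ^ p) atTop (𝓝 0) := by
  have hc : ContinuousOn (fun y : ℝ => |y| ^ p) (Set.Icc (-2) 2) :=
    (continuous_abs.rpow_const fun _ => Or.inr hp).continuousOn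
  have hu := isCompact_Icc.uniformContinuousOn_of_continuous hc
  rw [Metric.uniformContinuousOn_iff] at hu
  rw [Metric.tendsto_nhds]
  intro ε hε
  obtain ⟨δ, hδ, H⟩ := hu ε hε
  have h := (ricU_asymp m).1
  rw [Metric.tendsto_nhds] at h
  filter_upwards [h δ hδ, ricU_ev_bound m] with x hx hb
  have h1 := Real.abs_cos_le_one (x - m * (π / 2))
  have := H (ricU m x) (abs_le.1 hb) (cos (x - m * (π / 2))) (abs_le.1 (h1.trans (by norm_num)))
    (by rw [Real.dist_eq]; rw [Real.dist_eq, sub_zero] at hx; exact hx)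
  rw [Real.dist_eq] at this ⊢
  rw [sub_zero]; exact this

/-- Integrating a little-o. -/
lemma int_littleo (b : ℝ) (hb : -1 < b) (e : ℝ → ℝ) (hc : ContinuousOn e (Set.Ici 1))
    (he : Tendsto (fun z => e z / z ^ b) atTop (𝓝 0)) :
    Tendsto (fun T => (∫ z in (1:ℝ)..T, e z) / T ^ (b + 1)) atTop (𝓝 0) := by
  have hb1 : 0 < b + 1 := by linarith
  rw [Metric.tendsto_nhds] at he ⊢
  intro ε hε
  obtain ⟨M0, hM0⟩ := eventually_atTop.1 (he (ε * (b + 1) / 2) (by positivity))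
  set M := max M0 1 with hM
  have hM1 : 1 ≤ M := le_max_right _ _
  have hi : ∀ x y : ℝ, 1 ≤ x → 1 ≤ y → IntervalIntegrable e volume x y := fun x y hx hy =>
    (hc.mono fun z hz => le_trans (le_min hx hy) hz.1).intervalIntegrable
  have hK : Tendsto (fun T : ℝ => |∫ z in (1:ℝ)..M, e z| / T ^ (b + 1)) atTop (𝓝 0) :=
    tendsto_const_nhds.div_atTop (tendsto_rpow_atTop hb1)
  rw [Metric.tendsto_nhds] at hK
  filter_upwards [hK (ε / 2) (by positivity), eventually_ge_atTop M] with T hT hTM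
  have hT0 : 0 < T := by linarith
  have hTp : 0 < T ^ (b + 1) := by positivity
  rw [Real.dist_eq, sub_zero] at hT ⊢
  rw [abs_of_nonneg (by positivity), div_lt_iff₀ hTp] at hT
  rw [abs_div, abs_of_pos hTp, div_lt_iff₀ hTp,
    ← intervalIntegral.integral_add_adjacent_intervals (hi 1 M le_rfl hM1) (hi M T hM1 (by linarith))]
  have h2 : |∫ z in M..T, e z| ≤ ∫ z in M..T, (ε * (b + 1) / 2) * z ^ b := by
    rw [← Real.norm_eq_abs]
    refine intervalIntegral.norm_integral_le_of_norm_le hTM ?_ ?_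
    · refine Eventually.of_forall fun z hz => ?_
      have hz0 : 0 < z := by linarith [hz.1]
      have := hM0 z (by linarith [hz.1, le_max_left M0 1])
      rw [Real.dist_eq, sub_zero, abs_div, abs_of_pos (by positivity : 0 < z ^ b),
        div_lt_iff₀ (by positivity)] at this
      exact this.le
    · exact (intervalIntegral.intervalIntegrable_rpow' hb).const_mul _
  rw [intervalIntegral.integral_const_mul, integral_rpow (Or.inl hb)] at h2
  have h3 : ε * (b + 1) / 2 * ((T ^ (b + 1) - M ^ (b + 1)) / (b + 1)) =
      ε / 2 * (T ^ (b + 1) - M ^ (b + 1)) := by field_simp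
  rw [h3] at h2
  have hMp : 0 < M ^ (b + 1) := by positivity
  have := abs_add_le (∫ z in (1:ℝ)..M, e z) (∫ z in M..T, e z)
  nlinarith

lemma int_weighted (a : ℝ) (ha : -1 < a) (h s : ℝ → ℝ) (c : ℝ)
    (hh : ContinuousOn h (Set.Ici 1)) (hs : Continuous s) (hper : Function.Periodic s π)
    (hmean : ∫ z in (0:ℝ)..π, s z = π * c) (hd : Tendsto (fun z => h z - s z) atTop (𝓝 0)) :
    Tendsto (fun T => (∫ z in (1:ℝ)..T, z ^ a * h z) / T ^ (a + 1)) atTop (𝓝 (c / (a + 1))) := by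
  have ha1 : 0 < a + 1 := by linarith
  have hpow : ∀ r : ℝ, ContinuousOn (fun z : ℝ => z ^ r) (Set.Ici 1) := fun r z hz =>
    (Real.continuousAt_rpow_const z r
      (Or.inl (lt_of_lt_of_le one_pos hz).ne')).continuousWithinAt
  -- first part
  have p1 := int_littleo a ha (fun z => z ^ a * (h z - s z))
    ((hpow a).mul (hh.sub hs.continuousOn)) (by
      refine hd.congr' ?_
      filter_upwards [eventually_gt_atTop 0] with z hz
      have : 0 < z ^ a := by positivity
      field_simp)
  -- the primitive
  have hsc : Continuous fun z => s z - c := hs.sub continuous_const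
  set E : ℝ → ℝ := fun x => ∫ z in (0:ℝ)..x, (s z - c) with hE
  have hEd : ∀ x, HasDerivAt E (s x - c) x := fun x =>
    intervalIntegral.integral_hasDerivAt_right (hsc.intervalIntegrable _ _)
      hsc.stronglyMeasurable.stronglyMeasurableAtFilter hsc.continuousAt
  have hEc : Continuous E := continuous_iff_continuousAt.2 fun x => (hEd x).continuousAt
  have hEper : Function.Periodic E π := by
    intro x
    have h1 : Function.Periodic (fun z => s z - c) π := fun z => by simp only [hper z]
    have h2 := h1.intervalIntegral_add_eq x 0
    have h2' : ∫ z in (0:ℝ)..π, (s z - c) = 0 := by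
      rw [intervalIntegral.integral_sub (hs.intervalIntegrable _ _) (by simp), hmean,
        intervalIntegral.integral_const]
      simp
    rw [zero_add, h2'] at h2
    have h3 := intervalIntegral.integral_add_adjacent_intervals
      (hsc.intervalIntegrable (μ := volume) 0 x) (hsc.intervalIntegrable (μ := volume) x (x + π))
    rw [h2, add_zero] at h3
    exact h3.symm
  obtain ⟨B, hB⟩ := (hEper.isBounded_of_continuous Real.pi_ne_zero hEc).exists_norm_le
  have hB' : ∀ x, |E x| ≤ B := fun x => hB (E x) ⟨x, rfl⟩
  have hEdiv : Tendsto (fun z => E z / z) atTop (𝓝 0) := by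
    have h0 : Tendsto (fun z : ℝ => z⁻¹) atTop (𝓝 0) := tendsto_inv_atTop_zero
    have := h0.zero_mul_isBoundedUnder_le (g := E)
      (Filter.isBoundedUnder_of ⟨B, fun x => hB' x⟩)
    refine this.congr fun z => by ring
  have p2 := int_littleo a ha (fun z => (a * z ^ (a - 1)) * E z)
    ((continuousOn_const.mul (hpow (a - 1))).mul hEc.continuousOn) (by
      have := hEdiv.const_mul a
      rw [mul_zero] at this
      refine this.congr' ?_
      filter_upwards [eventually_gt_atTop 0] with z hz
      have : 0 < z ^ a := by positivity
      rw [Real.rpow_sub_one hz.ne']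
      field_simp)
  have p3 : Tendsto (fun T : ℝ => (E 1 + c / (a + 1)) / T ^ (a + 1)) atTop (𝓝 0) :=
    tendsto_const_nhds.div_atTop (tendsto_rpow_atTop ha1)
  have key := (((p1.add hEdiv).sub p2).sub p3).add (tendsto_const_nhds (x := c / (a + 1)))
  simp only [add_zero, sub_zero, zero_add] at key
  refine key.congr' ?_
  filter_upwards [eventually_ge_atTop 1] with T hT
  have hT0 : 0 < T := by linarith
  have hsub : Set.uIcc 1 T ⊆ Set.Ici (1:ℝ) := by
    rw [Set.uIcc_of_le hT]; exact fun z hz => hz.1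
  have i1 : IntervalIntegrable (fun z => z ^ a * (h z - s z)) volume 1 T :=
    (((hpow a).mul (hh.sub hs.continuousOn)).mono hsub).intervalIntegrable
  have i2 : IntervalIntegrable (fun z => z ^ a * (s z - c)) volume 1 T :=
    (((hpow a).mul hsc.continuousOn).mono hsub).intervalIntegrable
  have i3 : IntervalIntegrable (fun z => c * z ^ a) volume 1 T :=
    (intervalIntegral.intervalIntegrable_rpow' ha).const_mul _
  have split : (∫ z in (1:ℝ)..T, z ^ a * h z) = (∫ z in (1:ℝ)..T, z ^ a * (h z - s z)) +
      (∫ z in (1:ℝ)..T, z ^ a * (s z - c)) + ∫ z in (1:ℝ)..T, c * z ^ a := by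
    rw [← intervalIntegral.integral_add i1 i2, ← intervalIntegral.integral_add (i1.add i2) i3]
    refine intervalIntegral.integral_congr fun z _ => ?_
    ring
  have parts := intervalIntegral.integral_mul_deriv_eq_deriv_mul (a := 1) (b := T)
    (u := fun z : ℝ => z ^ a) (v := E) (u' := fun z => a * z ^ (a - 1)) (v' := fun z => s z - c)
    (fun x hx => Real.hasDerivAt_rpow_const (Or.inl (lt_of_lt_of_le one_pos (hsub hx)).ne'))
    (fun x _ => hEd x)
    (((continuousOn_const.mul (hpow (a - 1))).mono hsub).intervalIntegrable)
    (hsc.intervalIntegrable _ _)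
  rw [split, parts, intervalIntegral.integral_const_mul, integral_rpow (Or.inl ha)]
  have hTa : 0 < T ^ a := by positivity
  rw [Real.rpow_add_one hT0.ne', Real.one_rpow, Real.one_rpow]
  field_simp
  ring

lemma mean_pos (m : ℕ) (p : ℝ) (hp : 0 ≤ p) :
    0 < ∫ z in (0:ℝ)..π, |cos (z - m * (π / 2))| ^ p := by
  have hc : Continuous fun z : ℝ => |cos z| ^ p :=
    (Real.continuous_cos.abs).rpow_const fun _ => Or.inr hp
  have hper : Function.Periodic (fun z : ℝ => |cos z| ^ p) π := fun z => by
    simp only [Real.cos_add_pi, abs_neg]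
  rw [intervalIntegral.integral_comp_sub_right (fun z => |cos z| ^ p)]
  have e : π - m * (π / 2) = (0 - m * (π / 2)) + π := by ring
  rw [e, hper.intervalIntegral_add_eq _ (-(π / 2))]
  refine intervalIntegral.intervalIntegral_pos_of_pos_on (hc.intervalIntegrable _ _) ?_
    (by linarith [Real.pi_pos])
  intro x hx
  have : 0 < cos x := Real.cos_pos_of_mem_Ioo ⟨hx.1, by linarith [hx.2]⟩
  positivity

lemma f_eq (n : ℕ) (p z : ℝ) (hz : 0 < z) :
    z ^ 2 * |sbesselJ n z| ^ p = z ^ (2 - p) * |ricU (n + 1) z| ^ p := by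
  rw [sbesselJ_eq n z hz, abs_div, abs_of_pos hz, Real.div_rpow (abs_nonneg _) hz.le,
    Real.rpow_sub hz, Real.rpow_two]
  field_simp

lemma f_cont (n : ℕ) (p : ℝ) (hp : 0 ≤ p) :
    ContinuousOn (fun z => z ^ 2 * |sbesselJ n z| ^ p) (Set.Ioi 0) := by
  have : ContinuousOn (sbesselJ n) (Set.Ioi 0) := by
    refine ContinuousOn.congr (f := fun x => ricU (n + 1) x / x) ?_ fun x hx => sbesselJ_eq n x hx
    exact (ricU_cont n).2.div continuousOn_id fun x hx => ne_of_gt hx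
  exact (continuousOn_id.pow 2).mul (this.abs.rpow_const fun _ _ => Or.inr hp)

lemma f_int (n : ℕ) (p : ℝ) (hp : 0 ≤ p) (T : ℝ) (hT : 0 ≤ T) :
    IntervalIntegrable (fun z => z ^ 2 * |sbesselJ n z| ^ p) volume 0 T := by
  have h01 : IntervalIntegrable (fun z => z ^ 2 * |sbesselJ n z| ^ p) volume 0 1 := by
    rw [intervalIntegrable_iff_integrableOn_Ioc_of_le zero_le_one]
    obtain ⟨C, hC⟩ := sbesselJ_bound n
    refine IntegrableOn.of_bound (C := C ^ p) (by simp) ?_ ?_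
    · exact ((f_cont n p hp).mono fun z hz => hz.1).aestronglyMeasurable measurableSet_Ioc
    · refine (ae_restrict_iff' measurableSet_Ioc).2 (Eventually.of_forall fun z hz => ?_)
      rw [Real.norm_of_nonneg (by positivity)]
      have h1 : |sbesselJ n z| ^ p ≤ C ^ p := Real.rpow_le_rpow (abs_nonneg _) (hC z hz) hp
      have h2 : z ^ 2 ≤ 1 := pow_le_one₀ hz.1.le hz.2
      have h3 : 0 ≤ |sbesselJ n z| ^ p := by positivity
      nlinarith
  rcases eq_or_lt_of_le hT with rfl | hT
  · exact IntervalIntegrable.refl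
  · refine h01.trans (ContinuousOn.intervalIntegrable ?_)
    exact (f_cont n p hp).mono fun z hz => lt_of_lt_of_le (lt_min one_pos hT) hz.1

lemma F_asymp (n : ℕ) (p : ℝ) (hp : 1 ≤ p) (hp3 : p < 3) : ∃ L : ℝ, 0 < L ∧
    Tendsto (fun T => (∫ z in (0:ℝ)..T, z ^ 2 * |sbesselJ n z| ^ p) / T ^ (3 - p)) atTop (𝓝 L) := by
  have hp0 : 0 ≤ p := by linarith
  have hm := mean_pos (n + 1) p hp0
  set I := ∫ z in (0:ℝ)..π, |cos (z - (n + 1 : ℕ) * (π / 2))| ^ p with hI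
  have hs : Continuous fun z : ℝ => |cos (z - (n + 1 : ℕ) * (π / 2))| ^ p :=
    (by fun_prop : Continuous fun z : ℝ => |cos (z - (n + 1 : ℕ) * (π / 2))|).rpow_const
      fun _ => Or.inr hp0
  have h := int_weighted (2 - p) (by linarith) (fun z => |ricU (n + 1) z| ^ p)
    (fun z => |cos (z - (n + 1 : ℕ) * (π / 2))| ^ p) (I / π)
    (((ricU_cont n).2.mono (Set.Ici_subset_Ioi.2 one_pos)).abs.rpow_const
      fun _ _ => Or.inr hp0) hs
    (fun z => by
      have e : z + π - (n + 1 : ℕ) * (π / 2) = (z - (n + 1 : ℕ) * (π / 2)) + π := by ring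
      simp only [e, Real.cos_add_pi, abs_neg])
    (by rw [← hI]; field_simp) (ricU_pow_asymp (n + 1) p hp0)
  have e : 2 - p + 1 = 3 - p := by ring
  rw [e] at h
  have h3 : 0 < 3 - p := by linarith
  refine ⟨I / π / (3 - p), by have := Real.pi_pos; positivity, ?_⟩
  have h0 : Tendsto (fun T : ℝ => (∫ z in (0:ℝ)..1, z ^ 2 * |sbesselJ n z| ^ p) / T ^ (3 - p))
      atTop (𝓝 0) := tendsto_const_nhds.div_atTop (tendsto_rpow_atTop h3)
  have h4 := h0.add h
  rw [zero_add] at h4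
  refine h4.congr' ?_
  filter_upwards [eventually_ge_atTop 1] with T hT
  rw [← add_div]
  congr 1
  have i1 := f_int n p hp0 1 zero_le_one
  have i2 := f_int n p hp0 T (by linarith)
  rw [← intervalIntegral.integral_add_adjacent_intervals i1 (i1.symm.trans i2)]
  congr 1
  refine intervalIntegral.integral_congr fun z hz => ?_
  rw [Set.uIcc_of_le hT] at hz
  exact (f_eq n p z (lt_of_lt_of_le one_pos hz.1)).symm

lemma zeros_unbounded (n : ℕ) (M : ℝ) : ∃ x, M < x ∧ 0 < x ∧ sbesselJ n x = 0 := by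
  have h := (ricU_asymp n).2
  rw [Metric.tendsto_nhds] at h
  obtain ⟨A, hA⟩ := eventually_atTop.1 (h 1 one_pos)
  obtain ⟨N, hN⟩ := exists_nat_gt (max (max A M) 1)
  have hpi := Real.pi_gt_three
  set x : ℝ := ((n + 1 : ℕ) : ℝ) * (π / 2) + N * (2 * π) with hx
  have hNx : (N : ℝ) ≤ x := by
    have : (0:ℝ) ≤ ((n + 1 : ℕ) : ℝ) * (π / 2) := by positivity
    have : (0:ℝ) ≤ N := by positivity
    nlinarith
  have hA1 : A ≤ x := ((le_max_left _ _).trans (le_max_left _ _)).trans (hN.le.trans hNx)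
  have hM1 : M < x := ((le_max_right _ _).trans (le_max_left _ _)).trans_lt (hN.trans_le hNx)
  have h11 : 1 < x := (le_max_right _ _).trans_lt (hN.trans_le hNx)
  have u1 := hA x hA1
  have u2 := hA (x + π) (by linarith)
  have c1 : cos (x - ((n + 1 : ℕ) : ℝ) * (π / 2)) = 1 := by
    rw [hx, add_sub_cancel_left, Real.cos_nat_mul_two_pi]
  have c2 : cos (x + π - ((n + 1 : ℕ) : ℝ) * (π / 2)) = -1 := by
    have : x + π - ((n + 1 : ℕ) : ℝ) * (π / 2) = (x - ((n + 1 : ℕ) : ℝ) * (π / 2)) + π := by ring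
    rw [this, Real.cos_add_pi, c1]
  rw [c1, Real.dist_eq, sub_zero, abs_lt] at u1
  rw [c2, Real.dist_eq, sub_zero, abs_lt] at u2
  have hc : ContinuousOn (ricU (n + 1)) (Set.Icc x (x + π)) :=
    (ricU_cont n).2.mono fun z hz => lt_of_lt_of_le (by linarith) hz.1
  obtain ⟨y, hy, hy0⟩ := intermediate_value_Icc' (by linarith : x ≤ x + π) hc
    (show (0:ℝ) ∈ _ from ⟨by linarith, by linarith⟩)
  have hy1 : 0 < y := by linarith [hy.1]
  exact ⟨y, by linarith [hy.1], hy1, by rw [sbesselJ_eq n y hy1, hy0, zero_div]⟩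

/-- The denominator is bounded below eventually. -/
lemma F_pos (n : ℕ) (p : ℝ) (hp : 0 ≤ p) : ∃ c : ℝ, 0 < c ∧
    ∀ᶠ T in atTop, c ≤ ∫ z in (0:ℝ)..T, z ^ 2 * |sbesselJ n z| ^ p := by
  have h := (ricU_asymp n).2
  rw [Metric.tendsto_nhds] at h
  obtain ⟨A, hA⟩ := eventually_atTop.1 (h 1 one_pos)
  obtain ⟨N, hN⟩ := exists_nat_gt (max A 1)
  have hpi := Real.pi_gt_three
  set x : ℝ := ((n + 1 : ℕ) : ℝ) * (π / 2) + N * (2 * π) with hx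
  have hNx : (N : ℝ) ≤ x := by
    have : (0:ℝ) ≤ ((n + 1 : ℕ) : ℝ) * (π / 2) := by positivity
    have : (0:ℝ) ≤ N := by positivity
    nlinarith
  have hA1 : A ≤ x := (le_max_left _ _).trans (hN.le.trans hNx)
  have h11 : 1 < x := (le_max_right _ _).trans_lt (hN.trans_le hNx)
  have u1 := hA x hA1
  have c1 : cos (x - ((n + 1 : ℕ) : ℝ) * (π / 2)) = 1 := by
    rw [hx, add_sub_cancel_left, Real.cos_nat_mul_two_pi]
  rw [c1, Real.dist_eq, sub_zero, abs_lt] at u1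
  have hx0 : 0 < x := by linarith
  have hsub : Set.Icc x (x + 1) ⊆ Set.Ioi 0 := fun z hz => lt_of_lt_of_le hx0 hz.1
  refine ⟨∫ z in x..(x + 1), z ^ 2 * |sbesselJ n z| ^ p, ?_, ?_⟩
  · refine intervalIntegral.integral_pos (by linarith) ((f_cont n p hp).mono hsub)
      (fun z _ => by positivity) ⟨x, ⟨le_rfl, by linarith⟩, ?_⟩
    rw [f_eq n p x hx0]
    have : 0 < |ricU (n + 1) x| := abs_pos.2 (by linarith)
    positivity
  · filter_upwards [eventually_ge_atTop (x + 1)] with T hT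
    refine intervalIntegral.integral_mono_interval hx0.le (by linarith) hT ?_
      (f_int n p hp T (by linarith))
    exact Eventually.of_forall fun z => by
      simp only [Pi.zero_apply]; positivity

theorem focusing_modes_ball
    (n : ℕ) (R p : ℝ) (hR : R ∈ Set.Ioo (0 : ℝ) 1) (hp : 1 ≤ p) (hp3 : p ≠ 3)
    (γ : ℕ → ℝ)
    (hγ_pos : ∀ k : ℕ, 1 ≤ k → 0 < γ k)
    (hγ_zero : ∀ k : ℕ, 1 ≤ k → sbesselJ n (γ k) = 0)
    (hγ_mono : ∀ k l : ℕ, 1 ≤ k → k < l → γ k < γ l)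
    (hγ_surj : ∀ x : ℝ, 0 < x → sbesselJ n x = 0 → ∃ k, 1 ≤ k ∧ γ k = x) :
    (p < 3 → Tendsto (fun k : ℕ => focusRatioBall n R p (γ k)) atTop
        (𝓝 ((1 - R ^ (3 - p)) ^ (1 / p))))
    ∧ (3 < p → Tendsto (fun k : ℕ => focusRatioBall n R p (γ k)) atTop (𝓝 0)) := by
  have hR0 := hR.1
  have hR1 := hR.2
  have hp0 : 0 < p := by linarith
  have hγ : Tendsto γ atTop atTop := by
    rw [tendsto_atTop]
    intro M
    obtain ⟨x, hMx, hx0, hx⟩ := zeros_unbounded n M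
    obtain ⟨k, hk, rfl⟩ := hγ_surj x hx0 hx
    filter_upwards [eventually_gt_atTop k] with l hl
    exact (hMx.trans (hγ_mono k l hk hl)).le
  constructor
  · intro hlt
    have hq : 0 < 3 - p := by linarith
    obtain ⟨L, hL, hF⟩ := F_asymp n p hp hlt
    set F : ℝ → ℝ := fun T => ∫ z in (0:ℝ)..T, z ^ 2 * |sbesselJ n z| ^ p with hFd
    have h1 := hF.comp hγ
    have h2 := hF.comp (hγ.atTop_mul_const hR0)
    have h3 := ((h2.mul_const (R ^ (3 - p))).div h1 hL.ne').const_sub 1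
    have e : 1 - L * R ^ (3 - p) / L = 1 - R ^ (3 - p) := by field_simp
    rw [e] at h3
    have h4 := h3.rpow_const (p := 1 / p) (Or.inr (by positivity))
    refine h4.congr' ?_
    filter_upwards [hγ.eventually_gt_atTop 0, h1.eventually_ne hL.ne'] with k hk hne
    rw [focusRatioBall]
    congr 1
    have i1 := f_int n p hp0.le (γ k) hk.le
    have i2 := f_int n p hp0.le (γ k * R) (by positivity)
    rw [← intervalIntegral.integral_interval_sub_left i1 i2]
    change 1 - (F (γ k * R) / (γ k * R) ^ (3 - p)) * R ^ (3 - p) / (F (γ k) / (γ k) ^ (3 - p)) =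
      (F (γ k) - F (γ k * R)) / F (γ k)
    have hk' : 0 < γ k ^ (3 - p) := by positivity
    have hR' : 0 < R ^ (3 - p) := by positivity
    have hFne : F (γ k) ≠ 0 := fun h0 => hne (by
      change F (γ k) / (γ k) ^ (3 - p) = 0
      rw [h0, zero_div])
    rw [Real.mul_rpow hk.le hR0.le]
    field_simp
  · intro hgt
    obtain ⟨c, hc, hden⟩ := F_pos n p hp0.le
    obtain ⟨A, hA⟩ := eventually_atTop.1 (ricU_ev_bound (n + 1))
    have hz : Tendsto (fun T : ℝ => (2 ^ p * R ^ (2 - p) * (1 - R) / c) * T ^ (-(p - 3)))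
        atTop (𝓝 0) := by
      have := (tendsto_rpow_neg_atTop (by linarith : 0 < p - 3)).const_mul
        (2 ^ p * R ^ (2 - p) * (1 - R) / c)
      rwa [mul_zero] at this
    have hq : Tendsto (fun T : ℝ => (∫ z in (T * R)..T, z ^ 2 * |sbesselJ n z| ^ p) /
        (∫ z in (0 : ℝ)..T, z ^ 2 * |sbesselJ n z| ^ p)) atTop (𝓝 0) := by
      refine squeeze_zero_norm' ?_ hz
      filter_upwards [hden, eventually_gt_atTop 0,
        (tendsto_id.atTop_mul_const hR0).eventually_ge_atTop A] with T hT hT0 hTA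
      simp only [id] at hTA
      have hTR : 0 < T * R := by positivity
      have hle : T * R ≤ T := by nlinarith
      have hn : ‖∫ z in (T * R)..T, z ^ 2 * |sbesselJ n z| ^ p‖ ≤
          (2 ^ p * (T * R) ^ (2 - p)) * |T - T * R| := by
        refine intervalIntegral.norm_integral_le_of_norm_le_const fun z hz => ?_
        rw [Set.uIoc_of_le hle] at hz
        have hz0 : 0 < z := hTR.trans hz.1
        rw [Real.norm_of_nonneg (by positivity), f_eq n p z hz0, mul_comm]
        refine mul_le_mul ?_ ?_ (by positivity) (by positivity)
        · exact Real.rpow_le_rpow (abs_nonneg _) (hA z (hTA.trans hz.1.le)) hp0.le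
        · exact Real.rpow_le_rpow_of_nonpos hTR hz.1.le (by linarith)
      rw [norm_div]
      have hd : c ≤ ‖∫ z in (0 : ℝ)..T, z ^ 2 * |sbesselJ n z| ^ p‖ := hT.trans (le_abs_self _)
      refine (div_le_div₀ (by positivity) hn hc hd).trans (le_of_eq ?_)
      rw [abs_of_nonneg (by linarith), Real.mul_rpow hT0.le hR0.le]
      have e1 : -(p - 3) = (2 - p) + 1 := by ring
      rw [e1, Real.rpow_add_one hT0.ne']
      field_simp
    have h := (hq.comp hγ).rpow_const (p := 1 / p) (Or.inr (by positivity))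
    rw [Real.zero_rpow (by positivity)] at h
    exact h
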